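/- For all n ≥ 1, the number of rooted labeled forests on [n] avoiding all three patterns 321, 132, and 213, and likewise the number avoiding all three patterns 123, 312, and 231, both equal ∑_{k=1}^{n} (n!/k!)·C(n−1,k−1), where C(a,b) denotes the binomial coefficient. -/

import Mathlib

/-- A rooted labeled forest on `[n]`, encoded as a parent function
`p : Fin n → Option (Fin n)` (`p v = none` means `v` is a root).
Acyclicity is expressed by the existence of a depth function strictly
decreasing from each vertex to its parent. -/
def IsForest {n : ℕ} (p : Fin n → Option (Fin n)) : Prop :=
  ∃ d : Fin n → ℕ, ∀ v w : Fin n, p v = some w → d w < d v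

/-- `StrictAnc p a b` means `a` is a strict ancestor of `b` in the forest `p`. -/
def StrictAnc {n : ℕ} (p : Fin n → Option (Fin n)) (a b : Fin n) : Prop :=
  Relation.TransGen (fun x y : Fin n => p y = some x) a b

/-- The forest `p` contains the pattern `σ` (given in one-line notation):
there is a chain of vertices along some root-to-vertex path whose labels
are order-isomorphic to `σ`. -/
def ForestContains {n : ℕ} (p : Fin n → Option (Fin n)) (σ : List ℕ) : Prop :=
  ∃ u : Fin σ.length → Fin n,
    (∀ i j : Fin σ.length, i < j → StrictAnc p (u i) (u j)) ∧
    (∀ i j : Fin σ.length, σ.get i < σ.get j ↔ u i < u j)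

/-- The forest `p` avoids the pattern `σ`. -/
def ForestAvoids {n : ℕ} (p : Fin n → Option (Fin n)) (σ : List ℕ) : Prop :=
  ¬ ForestContains p σ

/-- Number of cycles (including fixed points) in the cycle decomposition of a
permutation. -/
def permNumCycles {n : ℕ} (π : Equiv.Perm (Fin n)) : ℕ :=
  π.cycleType.card + (Finset.univ.filter fun x => π x = x).card

/-- Unsigned Stirling number of the first kind: the number of permutations of
`[n]` with exactly `k` cycles. -/
noncomputable def stirlingFirst (n k : ℕ) : ℕ :=
  Nat.card {π : Equiv.Perm (Fin n) // permNumCycles π = k}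

/-- Stirling number of the second kind: the number of partitions of `[n]`
into `k` nonempty subsets. -/
noncomputable def stirlingSecond (n k : ℕ) : ℕ :=
  Nat.card {P : Finpartition (Finset.univ : Finset (Fin n)) // P.parts.card = k}

/-- The Bell number: the number of set partitions of `[n]`. -/
noncomputable def bellNumber (n : ℕ) : ℕ :=
  Nat.card (Finpartition (Finset.univ : Finset (Fin n)))

/-- A vertex is a top-down maximum if it is larger than all of its ancestors. -/
def IsTopDownMax {n : ℕ} (p : Fin n → Option (Fin n)) (v : Fin n) : Prop :=
  ∀ u : Fin n, StrictAnc p u v → u < v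

open Finset Relation

/-- A family of rankings of `Fin n`, the one attached to `r` starting at `r`, which are rotations
of one another. -/
structure IsCyclicKey {n : ℕ} (key : Fin n → Fin n → ℕ) : Prop where
  injective : ∀ r, Function.Injective (key r)
  self_lt : ∀ r v, v ≠ r → key r r < key r v
  rotate : ∀ r x y z, key r x < key r y → key r y < key r z → key x y < key x z

/-- The values a parent function may take at `v` if the root of each vertex is prescribed by `f`
and labels have to increase along paths for the ranking attached to the root. -/
def IsParentChoice {n : ℕ} (key : Fin n → Fin n → ℕ) (f : Fin n → Fin n) (v : Fin n) :
    Option (Fin n) → Prop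
  | none => f v = v
  | some w => f w = f v ∧ key (f v) w < key (f v) v

section Structure

variable {n : ℕ} {key : Fin n → Fin n → ℕ} {p : Fin n → Option (Fin n)} {f : Fin n → Fin n}

lemma forestContains_triple (p : Fin n → Option (Fin n)) (a b c : ℕ) :
    ForestContains p [a, b, c] ↔ ∃ x y z, StrictAnc p x y ∧ StrictAnc p x z ∧ StrictAnc p y z ∧
      (a < b ↔ x < y) ∧ (b < a ↔ y < x) ∧ (a < c ↔ x < z) ∧ (c < a ↔ z < x) ∧
      (b < c ↔ y < z) ∧ (c < b ↔ z < y) := by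
  constructor
  · rintro ⟨u, h1, h2⟩
    change Fin 3 → Fin n at u
    have h01 : (0 : Fin 3) < 1 := by decide
    have h02 : (0 : Fin 3) < 2 := by decide
    have h12 : (1 : Fin 3) < 2 := by decide
    exact ⟨u 0, u 1, u 2, h1 _ _ h01, h1 _ _ h02, h1 _ _ h12, h2 (0 : Fin 3) (1 : Fin 3),
      h2 (1 : Fin 3) (0 : Fin 3), h2 (0 : Fin 3) (2 : Fin 3), h2 (2 : Fin 3) (0 : Fin 3),
      h2 (1 : Fin 3) (2 : Fin 3), h2 (2 : Fin 3) (1 : Fin 3)⟩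
  · rintro ⟨x, y, z, hxy, hxz, hyz, h⟩
    have hlt : ∀ i j : Fin 3, i < j → StrictAnc p (![x, y, z] i) (![x, y, z] j) := by
      simp [Fin.forall_fin_succ, hxy, hxz, hyz]
    have hiff : ∀ i j : Fin 3, ![a, b, c] i < ![a, b, c] j ↔ ![x, y, z] i < ![x, y, z] j := by
      simp [Fin.forall_fin_succ, h]
    refine ⟨(![x, y, z] : Fin 3 → Fin n), hlt, fun (i : Fin 3) (j : Fin 3) => ?_⟩
    rw [← hiff]
    fin_cases i <;> fin_cases j <;> rfl

lemma StrictAnc.depth_lt {d : Fin n → ℕ} (hd : ∀ v w, p v = some w → d w < d v) {a b : Fin n}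
    (h : StrictAnc p a b) : d a < d b := by
  induction h with
  | single h => exact hd _ _ h
  | tail _ h ih => exact ih.trans (hd _ _ h)

lemma exists_root_map (hp : IsForest p) : ∃ f : Fin n → Fin n,
    (∀ v, p v = none → f v = v) ∧ (∀ v w, p v = some w → f w = f v) ∧
      ∀ v, f v = v ∨ StrictAnc p (f v) v := by
  obtain ⟨d, hd⟩ := hp
  have key : ∀ m v, d v < m → ∃! r, p r = none ∧ ReflTransGen (fun x y => p y = some x) r v := by
    intro m
    induction m with
    | zero => intro v hv; omega
    | succ m ih =>
      intro v hv
      rcases hpv : p v with _ | w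
      · refine ⟨v, ⟨hpv, .refl⟩, ?_⟩
        rintro r ⟨-, h⟩
        rcases h.cases_tail with h | ⟨c, -, h⟩
        · exact h.symm
        · simp [hpv] at h
      · obtain ⟨r, ⟨hr, hrw⟩, hu⟩ := ih w (by have := hd v w hpv; omega)
        refine ⟨r, ⟨hr, hrw.tail hpv⟩, ?_⟩
        rintro s ⟨hs, h⟩
        rcases h.cases_tail with rfl | ⟨c, hc, h⟩
        · simp [hpv] at hs
        · obtain rfl : w = c := by simpa [hpv] using h
          exact hu s ⟨hs, hc⟩
  choose f hf hu using fun v => key (d v + 1) v (Nat.lt_succ_self _)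
  refine ⟨f, fun v hv => (hu v v ⟨hv, .refl⟩).symm, fun v w hvw => ?_, fun v => ?_⟩
  · exact hu v (f w) ⟨(hf w).1, (hf w).2.tail hvw⟩
  · rcases reflTransGen_iff_eq_or_transGen.1 (hf v).2 with h | h
    · exact .inl h.symm
    · exact .inr h

lemma StrictAnc.key_lt (hf : ∀ v, IsParentChoice key f v (p v)) {a b : Fin n}
    (h : StrictAnc p a b) : f a = f b ∧ key (f b) a < key (f b) b := by
  have step : ∀ v w, p v = some w → f w = f v ∧ key (f v) w < key (f v) v := by
    intro v w hvw
    have := hf v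
    rwa [hvw] at this
  induction h with
  | single h => exact step _ _ h
  | tail _ h ih =>
    obtain ⟨h1, h2⟩ := step _ _ h
    refine ⟨ih.1.trans h1, ?_⟩
    rw [h1] at ih
    exact ih.2.trans h2

lemma IsCyclicKey.isForest_and_chain_iff (hk : IsCyclicKey key) (p : Fin n → Option (Fin n)) :
    (IsForest p ∧ ∀ x y z, StrictAnc p x y → StrictAnc p y z → key x y < key x z) ↔
      ∃ f, ∀ v, IsParentChoice key f v (p v) := by
  constructor
  · rintro ⟨hp, h⟩
    obtain ⟨f, h1, h2, h3⟩ := exists_root_map hp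
    obtain ⟨d, hd⟩ := hp
    refine ⟨f, fun v => ?_⟩
    rcases hpv : p v with _ | w
    · exact h1 v hpv
    · have hwv : StrictAnc p w v := .single hpv
      refine ⟨h2 v w hpv, ?_⟩
      rw [← h2 v w hpv]
      rcases h3 w with hw | hw
      · rw [hw]
        refine hk.self_lt _ _ ?_
        rintro rfl
        exact lt_irrefl _ (hwv.depth_lt hd)
      · exact h _ _ _ hw hwv
  · rintro ⟨f, hf⟩
    refine ⟨⟨fun v => key (f v) v, fun v w hvw => ?_⟩, fun x y z hxy hyz => ?_⟩
    · have := StrictAnc.key_lt hf (.single hvw : StrictAnc p w v)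
      simpa only [this.1] using this.2
    · have h1 := hxy.key_lt hf
      have h2 := hyz.key_lt hf
      rw [h2.1] at h1
      exact hk.rotate _ _ _ _ h1.2 h2.2

lemma IsParentChoice.root_map_unique {g : Fin n → Fin n}
    (hf : ∀ v, IsParentChoice key f v (p v)) (hg : ∀ v, IsParentChoice key g v (p v)) : f = g := by
  have : ∀ m v, key (f v) v < m → f v = g v := by
    intro m
    induction m with
    | zero => intro v hv; omega
    | succ m ih =>
      intro v hv
      have h1 := hf v
      have h2 := hg v
      rcases hpv : p v with _ | w <;> rw [hpv] at h1 h2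
      · exact h1.trans h2.symm
      · rw [← h1.1, ← h2.1]
        exact ih w (by rw [h1.1]; have := h1.2; omega)
  exact funext fun v => this _ v (Nat.lt_succ_self _)

lemma IsParentChoice.root_map_idem (hf : ∀ v, IsParentChoice key f v (p v)) (v : Fin n) :
    f (f v) = f v := by
  have : ∀ m v, key (f v) v < m → f (f v) = f v := by
    intro m
    induction m with
    | zero => intro v hv; omega
    | succ m ih =>
      intro v hv
      have h1 := hf v
      rcases hpv : p v with _ | w <;> rw [hpv] at h1
      · exact congrArg f h1
      · rw [← h1.1]
        exact ih w (by rw [h1.1]; have := h1.2; omega)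
  exact this _ v (Nat.lt_succ_self _)

lemma natCard_exists_root_map (key : Fin n → Fin n → ℕ) :
    Nat.card {p : Fin n → Option (Fin n) // ∃ f, ∀ v, IsParentChoice key f v (p v)} =
      ∑ f : Fin n → Fin n, Nat.card {p : Fin n → Option (Fin n) //
        ∀ v, IsParentChoice key f v (p v)} := by
  rw [← Nat.card_sigma]
  symm
  refine Nat.card_congr (Equiv.ofBijective (fun q => ⟨q.2.1, q.1, q.2.2⟩) ⟨?_, ?_⟩)
  · rintro ⟨f, p, hf⟩ ⟨g, q, hg⟩ h
    obtain rfl : p = q := congrArg Subtype.val h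
    obtain rfl := IsParentChoice.root_map_unique hf hg
    rfl
  · rintro ⟨p, f, hf⟩
    exact ⟨⟨f, p, hf⟩, rfl⟩

end Structure

section Counting

variable {n : ℕ} {key : Fin n → Fin n → ℕ}

lemma prod_card_filter_lt_eq_factorial {α : Type*} [DecidableEq α] (κ : α → ℕ)
    (hκ : Function.Injective κ) (r : α) (s : Finset α) (hs : ∀ v ∈ s, κ r < κ v) :
    ∏ v ∈ s, #{w ∈ insert r s | κ w < κ v} = (#s).factorial := by
  induction s using Finset.induction_on_max_value κ with
  | empty => simp
  | insert a s ha hmax ih =>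
    have hlt : ∀ w ∈ s, κ w < κ a := fun w hw =>
      (hmax w hw).lt_of_ne fun h => ha (hκ h ▸ hw)
    have hra : κ r < κ a := hs a (mem_insert_self _ _)
    have hr : r ∉ s := fun h => (hs r (mem_insert_of_mem h)).false
    rw [prod_insert ha, card_insert_of_notMem ha, Nat.factorial_succ,
      ← ih fun v hv => hs v (mem_insert_of_mem hv)]
    congr 1
    · rw [← card_insert_of_notMem hr]
      congr 1
      ext w
      simp only [mem_filter, mem_insert]
      constructor
      · rintro ⟨rfl | rfl | h, h'⟩
        · simp
        · exact absurd h' (lt_irrefl _)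
        · exact .inr h
      · rintro (rfl | h)
        · exact ⟨.inl rfl, hra⟩
        · exact ⟨.inr (.inr h), hlt w h⟩
    · refine prod_congr rfl fun v hv => ?_
      congr 1
      ext w
      simp only [mem_filter, mem_insert]
      constructor
      · rintro ⟨rfl | rfl | h, h'⟩
        · exact ⟨.inl rfl, h'⟩
        · exact absurd h' (hlt v hv).not_gt
        · exact ⟨.inr h, h'⟩
      · tauto

lemma sum_prod_factorial_card_fiber (α β : Type*) [Fintype α] [DecidableEq α] [Fintype β]
    [DecidableEq β] :
    ∑ g : α → β, ∏ b, (#{a | g a = b}).factorial =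
      (Fintype.card β).ascFactorial (Fintype.card α) := by
  have hfin : ∀ m, ∑ g : Fin m → β, ∏ b, (#{a | g a = b}).factorial =
      (Fintype.card β).ascFactorial m := by
    intro m
    induction m with
    | zero => simp
    | succ m ih =>
      rw [← (Fin.consEquiv fun _ => β).sum_comp, Fintype.sum_prod_type, sum_comm,
        Nat.ascFactorial_succ, ← ih, mul_sum]
      refine sum_congr rfl fun g _ => ?_
      have hcard : ∀ c b, #{a | (Fin.cons c g : Fin (m + 1) → β) a = b} =
          (if c = b then 1 else 0) + #{a | g a = b} := by
        intro c b
        rw [Fin.card_filter_univ_succ]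
        simp
        split_ifs <;> ring
      have hprod : ∀ c, ∏ b, (#{a | (Fin.cons c g : Fin (m + 1) → β) a = b}).factorial =
          (#{a | g a = c} + 1) * ∏ b, (#{a | g a = b}).factorial := by
        intro c
        rw [← mul_prod_erase univ _ (mem_univ c),
          ← mul_prod_erase univ (fun b => (#{a | g a = b}).factorial) (mem_univ c), ← mul_assoc,
          hcard, if_pos rfl, add_comm 1, Nat.factorial_succ]
        congr 1
        refine prod_congr rfl fun b hb => ?_
        rw [hcard, if_neg (ne_of_mem_erase hb).symm, zero_add]
      have hsum : ∑ c, #{a | g a = c} = m := by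
        simpa using (card_eq_sum_card_fiberwise (f := g) (s := univ) (t := univ)
          (fun _ _ => mem_univ _)).symm
      simp only [Fin.consEquiv_apply, hprod]
      rw [← sum_mul, sum_add_distrib, hsum]
      simp [add_comm]
  rw [← hfin (Fintype.card α)]
  let e := Fintype.equivFin α
  rw [← (e.arrowCongr (Equiv.refl β)).symm.sum_comp]
  refine sum_congr rfl fun g _ => prod_congr rfl fun b _ => ?_
  congr 1
  refine card_bij' (fun a _ => e a) (fun a _ => e.symm a) ?_ ?_ ?_ ?_ <;> simp

lemma IsCyclicKey.natCard_isParentChoice (hk : IsCyclicKey key) {f : Fin n → Fin n}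
    (hf : ∀ v, f (f v) = f v) :
    Nat.card {p : Fin n → Option (Fin n) // ∀ v, IsParentChoice key f v (p v)} =
      ∏ r with f r = r, (#{v | f v = r ∧ v ≠ r}).factorial := by
  rw [Nat.card_congr (Equiv.subtypePiEquivPi (p := fun v => IsParentChoice key f v)), Nat.card_pi]
  have hroot : ∀ v, f v = v → Nat.card {o // IsParentChoice key f v o} = 1 := by
    intro v hv
    rw [Nat.card_eq_one_iff_exists]
    refine ⟨⟨none, hv⟩, ?_⟩
    rintro ⟨_ | w, h⟩
    · rfl
    · have h2 := h.2
      rw [hv] at h2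
      by_cases hwv : w = v
      · simp [hwv] at h2
      · exact absurd (hk.self_lt v w hwv) h2.not_gt
  have hnonroot : ∀ v, f v ≠ v → Nat.card {o // IsParentChoice key f v o} =
      #{w | f w = f v ∧ key (f v) w < key (f v) v} := by
    intro v hv
    rw [← Nat.card_eq_finsetCard]
    symm
    refine Nat.card_congr (Equiv.ofBijective
      (fun w => ⟨some w.1, (mem_filter.1 w.2).2⟩) ⟨?_, ?_⟩)
    · intro a b h
      exact Subtype.ext (Option.some.inj (congrArg Subtype.val h))
    · rintro ⟨_ | w, h⟩
      · exact absurd h hv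
      · exact ⟨⟨w, mem_filter.2 ⟨mem_univ _, h⟩⟩, rfl⟩
  rw [← prod_fiberwise_of_maps_to (g := f) (s := univ) (t := {r | f r = r})
    (fun v _ => by simp [hf])]
  refine prod_congr rfl fun r hr => ?_
  have hr : f r = r := by simpa using hr
  rw [← prod_card_filter_lt_eq_factorial (key r) (hk.injective r) r]
  · rw [show univ.filter (fun v => f v = r) = insert r (univ.filter fun v => f v = r ∧ v ≠ r) by
      ext v; by_cases h : v = r <;> simp [h, hr], prod_insert (by simp), hroot r hr, one_mul]
    refine prod_congr rfl fun v hv => ?_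
    obtain ⟨h1, h2⟩ : f v = r ∧ v ≠ r := by simpa using hv
    rw [hnonroot v (by rw [h1]; exact h2.symm), h1]
    congr 1
    ext w
    by_cases h : w = r <;> simp [h, hr]
  · intro v hv
    exact hk.self_lt r v (by simpa using (mem_filter.1 hv).2.2)

lemma sum_idem_maps_with_fixed_points (R : Finset (Fin n)) :
    ∑ f : Fin n → Fin n with (∀ v, f (f v) = f v) ∧ univ.filter (fun r => f r = r) = R,
      ∏ r with f r = r, (#{v | f v = r ∧ v ≠ r}).factorial =
        (#R).ascFactorial (n - #R) := by
  have h := sum_prod_factorial_card_fiber {v // v ∉ R} {v // v ∈ R}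
  rw [Fintype.card_subtype_compl, Fintype.card_fin, Fintype.card_coe] at h
  rw [← h]
  symm
  refine sum_bij (fun g _ v => if hv : v ∈ R then v else g ⟨v, hv⟩) ?_ ?_ ?_ ?_
  · intro g _
    simp only [mem_filter, mem_univ, true_and]
    refine ⟨fun v => ?_, ?_⟩
    · by_cases hv : v ∈ R <;> simp [hv]
    · ext v
      by_cases hv : v ∈ R
      · simp [hv]
      · simp only [mem_filter, mem_univ, true_and, hv, dite_false, iff_false]
        exact fun h => hv (h ▸ (g ⟨v, hv⟩).2)
  · intro g _ g' _ h
    ext ⟨v, hv⟩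
    simpa [hv] using congrArg Fin.val (congrFun h v)
  · intro f hf
    obtain ⟨hidem, rfl⟩ := (mem_filter.1 hf).2
    refine ⟨fun v => ⟨f v, by simp [hidem]⟩, mem_univ _, ?_⟩
    ext v
    by_cases hv : f v = v <;> simp [hv]
  · intro g _
    have hfix : ({r | (if hv : r ∈ R then r else (g ⟨r, hv⟩ : Fin n)) = r} : Finset (Fin n)) = R := by
      ext v
      by_cases hv : v ∈ R
      · simp [hv]
      · simp only [mem_filter, mem_univ, true_and, hv, dite_false, iff_false]
        exact fun h => hv (h ▸ (g ⟨v, hv⟩).2)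
    rw [hfix, ← prod_coe_sort R]
    refine prod_congr rfl fun r _ => ?_
    congr 1
    refine card_bij (fun v _ => v) ?_ ?_ ?_
    · rintro ⟨v, hv⟩ h
      have hvr : v ≠ r := fun h => hv (h ▸ r.2)
      refine mem_filter.2 ⟨mem_univ _, ?_, hvr⟩
      simpa [hv] using congrArg Subtype.val (mem_filter.1 h).2
    · intro a _ b _ h
      exact Subtype.ext h
    · intro v h
      simp only [mem_filter, mem_univ, true_and] at h
      have hv : v ∉ R := fun hv => h.2 (by simpa [hv] using h.1)
      exact ⟨⟨v, hv⟩, mem_filter.2 ⟨mem_univ _, Subtype.ext (by simpa [hv] using h.1)⟩, rfl⟩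

lemma choose_mul_ascFactorial {n k : ℕ} (hk : 1 ≤ k) (hkn : k ≤ n) :
    n.choose k * k.ascFactorial (n - k) =
      (n.factorial / k.factorial) * (n - 1).choose (k - 1) := by
  obtain ⟨k, rfl⟩ := Nat.exists_eq_add_of_le' hk
  obtain ⟨m, rfl⟩ := Nat.exists_eq_add_of_le hkn
  have h1 : (k + 1 + m).factorial / (k + 1).factorial = (k + 2).ascFactorial m := by
    rw [← Nat.factorial_mul_ascFactorial, Nat.mul_div_cancel_left _ (Nat.factorial_pos _)]
  have h2 := Nat.choose_mul_factorial_mul_factorial (Nat.le_add_right (k + 1) m)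
  have h3 := Nat.choose_mul_factorial_mul_factorial (Nat.le_add_right k m)
  have h4 := Nat.factorial_mul_ascFactorial k m
  have h5 := Nat.factorial_mul_ascFactorial (k + 1) m
  rw [Nat.add_sub_cancel_left] at h2 h3
  rw [h1, Nat.add_sub_cancel_left, show k + 1 + m - 1 = k + m by omega,
    Nat.add_sub_cancel]
  have hpos : 0 < m.factorial * ((k + 1).factorial * k.factorial) := by positivity
  refine Nat.eq_of_mul_eq_mul_right hpos ?_
  calc _ = ((k + 1 + m).choose (k + 1) * (k + 1).factorial * m.factorial) *
        (k.factorial * (k + 1).ascFactorial m) := by ring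
    _ = ((k + m).choose k * k.factorial * m.factorial) *
        ((k + 1).factorial * (k + 1 + 1).ascFactorial m) := by rw [h2, h3, h4, h5]; ring
    _ = _ := by ring

theorem IsCyclicKey.natCard_forests (hk : IsCyclicKey key) (hn : 1 ≤ n) :
    Nat.card {p : Fin n → Option (Fin n) //
        IsForest p ∧ ∀ x y z, StrictAnc p x y → StrictAnc p y z → key x y < key x z} =
      ∑ k ∈ Icc 1 n, (n.factorial / k.factorial) * (n - 1).choose (k - 1) := by
  rw [Nat.card_congr (Equiv.subtypeEquivRight hk.isForest_and_chain_iff), natCard_exists_root_map,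
    ← sum_filter_of_ne (p := fun f : Fin n → Fin n => ∀ v, f (f v) = f v),
    sum_congr rfl fun f hf => hk.natCard_isParentChoice (mem_filter.1 hf).2,
    ← sum_fiberwise_of_maps_to (g := fun f : Fin n → Fin n => ({r | f r = r} : Finset (Fin n)))
      (t := univ.powerset) (fun f _ => mem_powerset.2 (subset_univ _))]
  · simp_rw [filter_filter, sum_idem_maps_with_fixed_points]
    rw [sum_powerset_apply_card (fun k => k.ascFactorial (n - k)), card_fin, sum_range_succ']
    have h0 : Nat.ascFactorial 0 n = 0 := by
      obtain ⟨m, rfl⟩ := Nat.exists_eq_add_of_le' hn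
      simp [Nat.zero_ascFactorial]
    simp only [smul_eq_mul, Nat.sub_zero, h0, mul_zero, add_zero]
    rw [range_eq_Ico, sum_Ico_add' (fun k => n.choose k * k.ascFactorial (n - k)) 0 n 1]
    refine sum_congr (by ext; simp) fun k hk => ?_
    obtain ⟨h1, h2⟩ := mem_Icc.1 hk
    exact choose_mul_ascFactorial h1 h2
  · intro f _ h v
    obtain ⟨p, hp⟩ := (Nat.card_ne_zero.1 h).1
    exact IsParentChoice.root_map_idem hp v

end Counting

/-- The position of `v` in the cyclic order of `Fin n` starting at `r`. -/
def ascKey {n : ℕ} (r v : Fin n) : ℕ := if r ≤ v then v - r else v + n - r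

/-- The position of `v` in the reversed cyclic order of `Fin n` starting at `r`. -/
def descKey {n : ℕ} (r v : Fin n) : ℕ := if v ≤ r then r - v else r + n - v

lemma isCyclicKey_ascKey (n : ℕ) : IsCyclicKey (ascKey (n := n)) where
  injective r v w h := by
    unfold ascKey at h
    split_ifs at h <;> omega
  self_lt r v h := by
    unfold ascKey
    split_ifs <;> omega
  rotate r x y z := by
    unfold ascKey
    split_ifs <;> omega

lemma isCyclicKey_descKey (n : ℕ) : IsCyclicKey (descKey (n := n)) where
  injective r v w h := by
    unfold descKey at h
    split_ifs at h <;> omega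
  self_lt r v h := by
    unfold descKey
    split_ifs <;> omega
  rotate r x y z := by
    unfold descKey
    split_ifs <;> omega

lemma IsForest.strictAnc_ne {n : ℕ} {p : Fin n → Option (Fin n)} (hp : IsForest p) {a b : Fin n}
    (h : StrictAnc p a b) : a ≠ b := by
  obtain ⟨d, hd⟩ := hp
  rintro rfl
  exact lt_irrefl _ (h.depth_lt hd)

lemma IsForest.avoids_321_132_213_iff {n : ℕ} {p : Fin n → Option (Fin n)} (hp : IsForest p) :
    (ForestAvoids p [3, 2, 1] ∧ ForestAvoids p [1, 3, 2] ∧ ForestAvoids p [2, 1, 3]) ↔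
      ∀ x y z, StrictAnc p x y → StrictAnc p y z → ascKey x y < ascKey x z := by
  simp only [ForestAvoids, forestContains_triple]
  constructor
  · rintro ⟨h1, h2, h3⟩ x y z hxy hyz
    have hxz := hxy.trans hyz
    have n1 := hp.strictAnc_ne hxy
    have n2 := hp.strictAnc_ne hxz
    have n3 := hp.strictAnc_ne hyz
    replace h1 : ¬(z < y ∧ y < x) :=
      fun _ => h1 ⟨x, y, z, hxy, hxz, hyz, by grind⟩
    replace h2 : ¬(x < z ∧ z < y) :=
      fun _ => h2 ⟨x, y, z, hxy, hxz, hyz, by grind⟩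
    replace h3 : ¬(y < x ∧ x < z) :=
      fun _ => h3 ⟨x, y, z, hxy, hxz, hyz, by grind⟩
    unfold ascKey
    split_ifs <;> omega
  · intro h
    refine ⟨?_, ?_, ?_⟩ <;>
    · rintro ⟨x, y, z, hxy, -, hyz, hlt⟩
      have := h x y z hxy hyz
      unfold ascKey at this
      split_ifs at this <;> omega

lemma IsForest.avoids_123_312_231_iff {n : ℕ} {p : Fin n → Option (Fin n)} (hp : IsForest p) :
    (ForestAvoids p [1, 2, 3] ∧ ForestAvoids p [3, 1, 2] ∧ ForestAvoids p [2, 3, 1]) ↔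
      ∀ x y z, StrictAnc p x y → StrictAnc p y z → descKey x y < descKey x z := by
  simp only [ForestAvoids, forestContains_triple]
  constructor
  · rintro ⟨h1, h2, h3⟩ x y z hxy hyz
    have hxz := hxy.trans hyz
    have n1 := hp.strictAnc_ne hxy
    have n2 := hp.strictAnc_ne hxz
    have n3 := hp.strictAnc_ne hyz
    replace h1 : ¬(x < y ∧ y < z) :=
      fun _ => h1 ⟨x, y, z, hxy, hxz, hyz, by grind⟩
    replace h2 : ¬(y < z ∧ z < x) :=
      fun _ => h2 ⟨x, y, z, hxy, hxz, hyz, by grind⟩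
    replace h3 : ¬(z < x ∧ x < y) :=
      fun _ => h3 ⟨x, y, z, hxy, hxz, hyz, by grind⟩
    unfold descKey
    split_ifs <;> omega
  · intro h
    refine ⟨?_, ?_, ?_⟩ <;>
    · rintro ⟨x, y, z, hxy, -, hyz, hlt⟩
      have := h x y z hxy hyz
      unfold descKey at this
      split_ifs at this <;> omega

theorem count_forests_avoiding_321_132_213_and_123_312_231 (n : ℕ) (hn : 1 ≤ n) :
    Nat.card {p : Fin n → Option (Fin n) //
        IsForest p ∧ ForestAvoids p [3, 2, 1] ∧ ForestAvoids p [1, 3, 2] ∧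
        ForestAvoids p [2, 1, 3]} =
      ∑ k ∈ Finset.Icc 1 n, (n.factorial / k.factorial) * (n - 1).choose (k - 1) ∧
    Nat.card {p : Fin n → Option (Fin n) //
        IsForest p ∧ ForestAvoids p [1, 2, 3] ∧ ForestAvoids p [3, 1, 2] ∧
        ForestAvoids p [2, 3, 1]} =
      ∑ k ∈ Finset.Icc 1 n, (n.factorial / k.factorial) * (n - 1).choose (k - 1) := by
  exact ⟨(Nat.card_congr (Equiv.subtypeEquivRight fun _ => and_congr_right
      IsForest.avoids_321_132_213_iff)).trans ((isCyclicKey_ascKey n).natCard_forests hn),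
    (Nat.card_congr (Equiv.subtypeEquivRight fun _ => and_congr_right
      IsForest.avoids_123_312_231_iff)).trans ((isCyclicKey_descKey n).natCard_forests hn)⟩
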